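/- arXiv:0805.4172 — 2 statements merged into one kernel-verified Lean document; each statement's English description precedes it below -/
import Mathlib

section
/- Let n ≥ 1, let v : ℝⁿ → ℝ be continuous with compact support, and let E > 0. Then the function (q,p) ↦ 𝟙[½‖p‖² ≤ E] − 𝟙[½‖p‖² + v(q) ≤ E] is Lebesgue integrable on ℝⁿ × ℝⁿ, and its integral equals κₙ (2E)^{n/2} ∫_{ℝⁿ} (1 − (max(1 − v(q)/E, 0))^{n/2}) dq, where κₙ = π^{n/2}/Γ(1 + n/2) is the volume of the unit ball in ℝⁿ. -/
open MeasureTheory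

/-- The volume of `{p | ½‖p‖² ≤ c}`, as the integral of its indicator function. -/
lemma integral_kinetic_sublevel_indicator {n : ℕ} (hn : 1 ≤ n) (c : ℝ) :
    Integrable (fun p : EuclideanSpace ℝ (Fin n) =>
      if (1/2) * ‖p‖^2 ≤ c then (1:ℝ) else 0) ∧
    ∫ p : EuclideanSpace ℝ (Fin n), (if (1/2) * ‖p‖^2 ≤ c then (1:ℝ) else 0) =
      (Real.pi ^ ((n:ℝ)/2) / Real.Gamma (1 + (n:ℝ)/2)) * (max (2*c) 0) ^ ((n:ℝ)/2) := by
  have hn' : (n:ℝ) / 2 ≠ 0 := by positivity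
  rcases lt_or_ge c 0 with hc | hc
  · have h (p : EuclideanSpace ℝ (Fin n)) : ¬ (1/2) * ‖p‖^2 ≤ c := by
      have := sq_nonneg ‖p‖
      linarith
    simp only [h, if_false]
    rw [max_eq_right (by linarith), Real.zero_rpow hn']
    simp
  · have : Nonempty (Fin n) := ⟨⟨0, hn⟩⟩
    have h : (fun p : EuclideanSpace ℝ (Fin n) => if (1/2) * ‖p‖^2 ≤ c then (1:ℝ) else 0) =
        (Metric.closedBall 0 √(2*c)).indicator (fun _ => (1:ℝ)) := by
      ext p
      have : (1/2) * ‖p‖^2 ≤ c ↔ p ∈ Metric.closedBall (0 : EuclideanSpace ℝ (Fin n)) √(2*c) := by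
        rw [mem_closedBall_zero_iff, Real.le_sqrt (norm_nonneg p) (by positivity)]
        constructor <;> intro h <;> linarith
      by_cases hp : (1/2) * ‖p‖^2 ≤ c
      · rw [if_pos hp, Set.indicator_of_mem (this.1 hp)]
      · rw [if_neg hp, Set.indicator_of_notMem (mt this.2 hp)]
    have sqrt_pow {x : ℝ} (hx : 0 ≤ x) : √x ^ n = x ^ ((n:ℝ)/2) := by
      rw [Real.sqrt_eq_rpow, ← Real.rpow_mul_natCast hx]
      congr 1
      ring
    rw [h]
    refine ⟨(integrable_indicator_iff measurableSet_closedBall).2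
      (integrableOn_const measure_closedBall_lt_top.ne), ?_⟩
    rw [integral_indicator_const _ measurableSet_closedBall, measureReal_def,
      EuclideanSpace.volume_closedBall, Fintype.card_fin, ENNReal.toReal_mul, ENNReal.toReal_pow,
      ENNReal.toReal_ofReal (Real.sqrt_nonneg _),
      ENNReal.toReal_ofReal (div_nonneg (by positivity) (Real.Gamma_nonneg_of_nonneg (by positivity))),
      sqrt_pow (by positivity), sqrt_pow Real.pi_pos.le, max_eq_left (by positivity),
      smul_eq_mul, mul_one, mul_comm, add_comm (1:ℝ)]

/-- A compactly supported continuous perturbation changes the sublevel sets of the kinetic energy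
only inside a bounded region of phase space. -/
lemma integrable_sublevel_indicator_sub {n : ℕ} {v : EuclideanSpace ℝ (Fin n) → ℝ}
    (hvc : Continuous v) (hsupp : HasCompactSupport v) (E : ℝ) :
    Integrable (fun x : EuclideanSpace ℝ (Fin n) × EuclideanSpace ℝ (Fin n) =>
      (if (1/2) * ‖x.2‖^2 ≤ E then (1:ℝ) else 0) -
      (if (1/2) * ‖x.2‖^2 + v x.1 ≤ E then (1:ℝ) else 0)) := by
  obtain ⟨C, hC⟩ := hsupp.exists_bound_of_continuous hvc
  have hC0 : 0 ≤ C := (norm_nonneg _).trans (hC 0)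
  let K := tsupport v ×ˢ Metric.closedBall (0 : EuclideanSpace ℝ (Fin n)) √(2 * (E + C))
  have hK : IsCompact K := hsupp.isCompact.prod (isCompact_closedBall _ _)
  have hbound : Integrable (K.indicator fun _ => (1:ℝ)) :=
    (integrable_indicator_iff hK.measurableSet).2 (integrableOn_const hK.measure_lt_top.ne)
  refine hbound.mono' (Measurable.aestronglyMeasurable ?_) (.of_forall fun x => ?_)
  · exact (Measurable.ite (measurableSet_le (by fun_prop) (by fun_prop)) (by fun_prop)
      (by fun_prop)).sub (Measurable.ite (measurableSet_le (by fun_prop) (by fun_prop))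
      (by fun_prop) (by fun_prop))
  by_cases hx : x ∈ K
  · rw [Set.indicator_of_mem hx]
    split_ifs <;> norm_num
  · rw [Set.indicator_of_notMem hx]
    by_cases hv : x.1 ∈ tsupport v
    · have hp : ¬ ‖x.2‖ ≤ √(2 * (E + C)) := fun h =>
        hx ⟨hv, mem_closedBall_zero_iff.2 h⟩
      have hlt : 2 * (E + C) < ‖x.2‖ ^ 2 := Real.lt_sq_of_sqrt_lt (not_le.1 hp)
      have := (abs_le.1 (hC x.1)).1
      rw [if_neg (by linarith), if_neg (by linarith)]
      simp
    · simp [image_eq_zero_of_notMem_tsupport hv]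

/-- For `v` continuous with compact support and `E > 0`, the difference of
indicators `𝟙[½‖p‖² ≤ E] − 𝟙[½‖p‖² + v(q) ≤ E]` is integrable on `ℝⁿ × ℝⁿ` and its integral
equals `κₙ (2E)^{n/2} ∫ (1 − (max(1 − v(q)/E, 0))^{n/2}) dq`, with
`κₙ = π^{n/2}/Γ(1+n/2)` the volume of the unit ball. -/
theorem regularised_phase_space_volume_formula
    (n : ℕ) (hn : 1 ≤ n)
    (v : EuclideanSpace ℝ (Fin n) → ℝ) (hvc : Continuous v) (hsupp : HasCompactSupport v)
    (E : ℝ) (hE : 0 < E) :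
    Integrable (fun x : EuclideanSpace ℝ (Fin n) × EuclideanSpace ℝ (Fin n) =>
      (if (1/2) * ‖x.2‖^2 ≤ E then (1:ℝ) else 0) -
      (if (1/2) * ‖x.2‖^2 + v x.1 ≤ E then (1:ℝ) else 0)) ∧
    (∫ x : EuclideanSpace ℝ (Fin n) × EuclideanSpace ℝ (Fin n),
      ((if (1/2) * ‖x.2‖^2 ≤ E then (1:ℝ) else 0) -
       (if (1/2) * ‖x.2‖^2 + v x.1 ≤ E then (1:ℝ) else 0)))
    = (Real.pi ^ ((n:ℝ)/2) / Real.Gamma (1 + (n:ℝ)/2)) * (2*E) ^ ((n:ℝ)/2) *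
      ∫ q : EuclideanSpace ℝ (Fin n), (1 - (max (1 - v q / E) 0) ^ ((n:ℝ)/2)) := by
  have hint := integrable_sublevel_indicator_sub hvc hsupp E
  refine ⟨hint, ?_⟩
  rw [Measure.volume_eq_prod] at hint ⊢
  rw [integral_prod _ hint, ← integral_const_mul]
  congr 1
  ext q
  obtain ⟨hi₀, h₀⟩ := integral_kinetic_sublevel_indicator hn E
  obtain ⟨hi, h⟩ := integral_kinetic_sublevel_indicator hn (E - v q)
  have hscale : max (2 * (E - v q)) 0 = 2 * E * max (1 - v q / E) 0 := by
    rw [mul_max_of_nonneg _ _ (by positivity), mul_zero]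
    congr 1
    field_simp
  simp only [← le_sub_iff_add_le]
  rw [integral_sub hi₀ hi, h₀, h, hscale, max_eq_left (by positivity),
    Real.mul_rpow (by positivity) (le_max_right _ _)]
  ring
end

section
/- Let v : ℝ² → ℝ be continuous with compact support and let E > max(0, sup v). Then ∫_{ℝ²×ℝ²} (𝟙[½‖p‖² ≤ E] − 𝟙[½‖p‖² + v(q) ≤ E]) d(q,p) = 2π ∫_{ℝ²} v(q) dq. In particular, the regularised phase space volume ξ(E) is independent of E on the interval (max(0, sup v), ∞). -/
open MeasureTheory

lemma ite_half_norm_sq_eq_indicator {F : Type*} [SeminormedAddCommGroup F] {c : ℝ} (hc : 0 ≤ c) :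
    (fun p : F => if (1/2) * ‖p‖^2 ≤ c then (1:ℝ) else 0)
      = (Metric.closedBall 0 (√(2 * c))).indicator 1 := by
  ext p
  have h : (1/2) * ‖p‖^2 ≤ c ↔ p ∈ Metric.closedBall 0 (√(2 * c)) := by
    rw [mem_closedBall_zero_iff, Real.le_sqrt (norm_nonneg _) (by positivity)]
    constructor <;> intro h <;> linarith
  by_cases hp : (1/2) * ‖p‖^2 ≤ c
  · rw [if_pos hp, Set.indicator_of_mem (h.1 hp), Pi.one_apply]
  · rw [if_neg hp, Set.indicator_of_notMem (mt h.2 hp)]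

lemma integrable_ite_half_norm_sq {c : ℝ} (hc : 0 ≤ c) :
    Integrable (fun p : EuclideanSpace ℝ (Fin 2) => if (1/2) * ‖p‖^2 ≤ c then (1:ℝ) else 0) := by
  rw [ite_half_norm_sq_eq_indicator hc]
  exact (integrable_indicator_iff measurableSet_closedBall).2
    (integrableOn_const (C := (1:ℝ)) measure_closedBall_lt_top.ne)

lemma integral_ite_half_norm_sq {c : ℝ} (hc : 0 ≤ c) :
    ∫ p : EuclideanSpace ℝ (Fin 2), (if (1/2) * ‖p‖^2 ≤ c then (1:ℝ) else 0)
      = 2 * Real.pi * c := by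
  rw [ite_half_norm_sq_eq_indicator hc, integral_indicator_one measurableSet_closedBall,
    measureReal_def, EuclideanSpace.volume_closedBall_fin_two, ENNReal.toReal_mul,
    ENNReal.toReal_pow, ENNReal.toReal_ofReal (Real.sqrt_nonneg _), Real.sq_sqrt (by positivity),
    ENNReal.toReal_ofReal Real.pi_pos.le]
  ring

lemma integrable_ite_sub_ite {v : EuclideanSpace ℝ (Fin 2) → ℝ} (hvc : Continuous v)
    (hsupp : HasCompactSupport v) (E : ℝ) :
    Integrable (fun x : EuclideanSpace ℝ (Fin 2) × EuclideanSpace ℝ (Fin 2) =>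
      ((if (1/2) * ‖x.2‖^2 ≤ E then (1:ℝ) else 0) -
       (if (1/2) * ‖x.2‖^2 + v x.1 ≤ E then (1:ℝ) else 0))) := by
  obtain ⟨M, hM⟩ := hsupp.exists_bound_of_continuous hvc
  set K := tsupport v ×ˢ
    Metric.closedBall (0 : EuclideanSpace ℝ (Fin 2)) (√(2 * (E + M)))
  have hK : IsCompact K := hsupp.isCompact.prod (isCompact_closedBall _ _)
  have hmeas : Measurable (fun x : EuclideanSpace ℝ (Fin 2) × EuclideanSpace ℝ (Fin 2) =>
      ((if (1/2) * ‖x.2‖^2 ≤ E then (1:ℝ) else 0) -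
       (if (1/2) * ‖x.2‖^2 + v x.1 ≤ E then (1:ℝ) else 0))) := by
    refine Measurable.sub ?_ ?_ <;>
      refine Measurable.ite (measurableSet_le ?_ measurable_const)
        measurable_const measurable_const <;>
      exact Continuous.measurable (by fun_prop)
  refine (integrableOn_iff_integrable_of_support_subset (s := K) ?_).1
    (Measure.integrableOn_of_bounded (M := 1) hK.measure_lt_top.ne hmeas.aestronglyMeasurable
      (Filter.Eventually.of_forall fun x => ?_))
  · intro x hx
    rw [Function.mem_support] at hx
    have hMx := abs_le.1 (hM x.1)
    refine ⟨?_, ?_⟩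
    · by_contra hq
      simp [image_eq_zero_of_notMem_tsupport hq] at hx
    · rw [mem_closedBall_zero_iff]
      apply Real.le_sqrt_of_sq_le
      by_contra! hp
      apply hx
      rw [if_neg (by linarith), if_neg (by linarith), sub_zero]
  · split_ifs <;> norm_num

/-- In dimension `n = 2`, for `v` continuous with compact support and
`E > max(0, sup v)`, the regularised phase space volume equals `2π ∫ v(q) dq`;
in particular it is independent of `E` on `(max(0, sup v), ∞)`. -/
theorem regularised_phase_space_volume_dim_two
    (v : EuclideanSpace ℝ (Fin 2) → ℝ) (hvc : Continuous v) (hsupp : HasCompactSupport v)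
    (E : ℝ) (hE : max 0 (sSup (Set.range v)) < E) :
    (∫ x : EuclideanSpace ℝ (Fin 2) × EuclideanSpace ℝ (Fin 2),
      ((if (1/2) * ‖x.2‖^2 ≤ E then (1:ℝ) else 0) -
       (if (1/2) * ‖x.2‖^2 + v x.1 ≤ E then (1:ℝ) else 0)))
    = 2 * Real.pi * ∫ q : EuclideanSpace ℝ (Fin 2), v q := by
  obtain ⟨hE0, hEv⟩ := max_lt_iff.1 hE
  have hint := integrable_ite_sub_ite hvc hsupp E
  rw [Measure.volume_eq_prod] at hint ⊢
  rw [integral_prod _ hint, ← integral_const_mul]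
  congr 1 with q
  have hq : 0 ≤ E - v q := by
    have := le_csSup (hsupp.isCompact_range hvc).bddAbove (Set.mem_range_self q)
    linarith
  simp only [← le_sub_iff_add_le]
  rw [integral_sub (integrable_ite_half_norm_sq hE0.le) (integrable_ite_half_norm_sq hq),
    integral_ite_half_norm_sq hE0.le, integral_ite_half_norm_sq hq]
  ring
end
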